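/- arXiv:2212.01943 — 3 statements merged into one kernel-verified Lean document; each statement's English description precedes it below -/
import Mathlib

section
/- Let Y ~ Pois(μ) with independent copy Ỹ, and let g : ℤ_+^n → ℝ^n satisfy E‖g(Y)‖² < ∞ and E|Y_i g_i(Y−e_i)| < ∞ for each i. Then E[‖Y‖² + ‖g(Y)‖² − 2⟨g_−(Y), Y⟩] = E‖Ỹ − g(Y)‖², i.e., UE^sqr(Y) = ‖Y‖² + ‖g(Y)‖² − 2⟨g_−(Y), Y⟩ is an unbiased estimator of the squared-loss test error Err^sqr(g) = E‖Ỹ − g(Y)‖². -/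
open MeasureTheory ProbabilityTheory Filter Set

noncomputable section

/-- Euclidean inner product on `ℝ^n`. -/
def dotR {n : ℕ} (u v : Fin n → ℝ) : ℝ := ∑ i, u i * v i

/-- Bregman divergence `D_φ(a,b) = φ(a) - φ(b) - ⟨∇φ(b), a - b⟩`, with gradient `φ'`. -/
def breg {n : ℕ} (φ : (Fin n → ℝ) → ℝ) (φ' : (Fin n → ℝ) → Fin n → ℝ)
    (a b : Fin n → ℝ) : ℝ :=
  φ a - φ b - dotR (φ' b) (fun i => a i - b i)

/-- Coercion of a nonnegative-integer vector to a real vector. -/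
def toR {n : ℕ} (y : Fin n → ℕ) : Fin n → ℝ := fun i => (y i : ℝ)

/-- `φ` is differentiable everywhere with gradient `φ'`. -/
def HasGrad {n : ℕ} (φ : (Fin n → ℝ) → ℝ) (φ' : (Fin n → ℝ) → Fin n → ℝ) : Prop :=
  ∀ x, HasFDerivAt φ (∑ i, φ' x i • (ContinuousLinearMap.proj i : (Fin n → ℝ) →L[ℝ] ℝ)) x

/-- Joint pmf of `n` independent Poisson coordinates with mean vector `ν`. -/
def poisPMF {n : ℕ} (ν : Fin n → ℝ) (y : Fin n → ℕ) : ℝ :=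
  ∏ i, Real.exp (-ν i) * ν i ^ y i / Nat.factorial (y i)

/-- `Y ~ Pois(ν)`: the coordinates of `Y` are independent Poissons with means `ν i`. -/
def HasPoissonLaw {Ω : Type*} [MeasurableSpace Ω] {n : ℕ} (P : Measure Ω)
    (ν : Fin n → ℝ) (Y : Ω → Fin n → ℕ) : Prop :=
  ∀ y, P {ω | Y ω = y} = ENNReal.ofReal (poisPMF ν y)

/-- Independence of two discrete random vectors, via factorization of the joint pmf. -/
def IndepDiscrete {Ω : Type*} [MeasurableSpace Ω] {n : ℕ} (P : Measure Ω)
    (Y Z : Ω → Fin n → ℕ) : Prop :=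
  ∀ y z, P {ω | Y ω = y ∧ Z ω = z} = P {ω | Y ω = y} * P {ω | Z ω = z}

/-- Binomial(m, p) pmf at `k`. -/
def binomPMF (m k : ℕ) (p : ℝ) : ℝ := (m.choose k : ℝ) * p ^ k * (1 - p) ^ (m - k)

/-- Joint pmf of independent binomials `ω_i ~ Binom(y_i, p)`. -/
def binomJointPMF {n : ℕ} (y : Fin n → ℕ) (p : ℝ) (w : Fin n → ℕ) : ℝ :=
  ∏ i, binomPMF (y i) (w i) p

open scoped NNReal ENNReal

theorem poisPMF_nonneg {n : ℕ} {ν : Fin n → ℝ} (hν : ∀ i, 0 ≤ ν i) (y : Fin n → ℕ) :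
    0 ≤ poisPMF ν y :=
  Finset.prod_nonneg fun i _ => by have := hν i; positivity

theorem poisPMF_add_single {n : ℕ} (ν : Fin n → ℝ) (y : Fin n → ℕ) (i : Fin n) :
    ((y i : ℝ) + 1) * poisPMF ν (y + Pi.single i 1) = ν i * poisPMF ν y := by
  unfold poisPMF
  rw [← Finset.mul_prod_erase _ _ (Finset.mem_univ i),
    ← Finset.mul_prod_erase (a := i) _ (fun j => Real.exp (-ν j) * ν j ^ y j / _)
      (Finset.mem_univ i)]
  have h : ∏ j ∈ Finset.univ.erase i, Real.exp (-ν j) * ν j ^ (y + Pi.single i 1 : Fin n → ℕ) j /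
        Nat.factorial ((y + Pi.single i 1 : Fin n → ℕ) j)
      = ∏ j ∈ Finset.univ.erase i, Real.exp (-ν j) * ν j ^ y j / Nat.factorial (y j) := by
    refine Finset.prod_congr rfl fun j hj => ?_
    simp [Pi.single_eq_of_ne (Finset.ne_of_mem_erase hj)]
  rw [h]
  simp only [Pi.add_apply, Pi.single_eq_same, Nat.factorial_succ, pow_succ]
  push_cast
  have : (y i : ℝ) + 1 ≠ 0 := by positivity
  field_simp

/-- Weighting the law `Pois(ν)` by its `i`-th coordinate shifts it by `e_i` and scales by `ν i`. -/
theorem withDensity_poisson_eq_map {n : ℕ} {ν : Fin n → ℝ} (hν : ∀ i, 0 ≤ ν i)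
    {m : Measure (Fin n → ℕ)} (hm : ∀ y, m {y} = ENNReal.ofReal (poisPMF ν y)) (i : Fin n) :
    m.withDensity (fun y => ((y i : ℝ≥0) : ℝ≥0∞))
      = ENNReal.ofReal (ν i) • m.map (fun y => y + Pi.single i 1) := by
  refine Measure.ext_of_singleton fun y => ?_
  rw [withDensity_apply _ (measurableSet_singleton y), lintegral_singleton, Measure.smul_apply,
    Measure.map_apply .of_discrete (measurableSet_singleton y), smul_eq_mul]
  rcases Nat.eq_zero_or_pos (y i) with h0 | h0
  · have : (fun z : Fin n → ℕ => z + Pi.single i 1) ⁻¹' {y} = ∅ := by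
      ext z
      simp only [mem_preimage, mem_singleton_iff, mem_empty_iff_false, iff_false]
      rintro rfl
      simp at h0
    simp [this, h0]
  · obtain ⟨z, rfl⟩ : ∃ z : Fin n → ℕ, y = z + Pi.single i 1 := by
      refine ⟨y - Pi.single i 1, (tsub_add_cancel_of_le fun j => ?_).symm⟩
      rcases eq_or_ne j i with rfl | hj
      · simpa using Nat.one_le_iff_ne_zero.2 h0.ne'
      · simp [hj]
    have : (fun z : Fin n → ℕ => z + Pi.single i 1) ⁻¹' {z + Pi.single i 1} = {z} := by
      ext w
      simp
    rw [this, hm, hm, ← ENNReal.ofReal_mul (hν i), ← poisPMF_add_single,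
      ENNReal.ofReal_mul (by positivity)]
    congr 1
    simp [ENNReal.ofReal_add]

/-- The Chen–Stein identity for the Poisson law. -/
theorem integral_coord_mul_poisson {n : ℕ} {ν : Fin n → ℝ} (hν : ∀ i, 0 ≤ ν i)
    {m : Measure (Fin n → ℕ)} (hm : ∀ y, m {y} = ENNReal.ofReal (poisPMF ν y)) (i : Fin n)
    (h : (Fin n → ℕ) → ℝ) :
    ∫ y, (y i : ℝ) * h y ∂m = ν i * ∫ y, h (y + Pi.single i 1) ∂m := by
  have h1 := integral_withDensity_eq_integral_smul (μ := m)
    (f := fun y : Fin n → ℕ => (y i : ℝ≥0)) .of_discrete h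
  rw [withDensity_poisson_eq_map hν hm, integral_smul_measure,
    integral_map .of_discrete .of_discrete, ENNReal.toReal_ofReal (hν i)] at h1
  simpa [NNReal.smul_def] using h1.symm

theorem integrable_coord_mul_poisson {n : ℕ} {ν : Fin n → ℝ} (hν : ∀ i, 0 ≤ ν i)
    {m : Measure (Fin n → ℕ)} (hm : ∀ y, m {y} = ENNReal.ofReal (poisPMF ν y)) (i : Fin n)
    {h : (Fin n → ℕ) → ℝ} (hh : Integrable (fun y => h (y + Pi.single i 1)) m) :
    Integrable (fun y => (y i : ℝ) * h y) m := by
  have h1 := integrable_withDensity_iff_integrable_smul (μ := m)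
    (f := fun y : Fin n → ℕ => (y i : ℝ≥0)) .of_discrete (g := h)
  rw [withDensity_poisson_eq_map hν hm] at h1
  have h2 : Integrable h (m.map (fun y => y + Pi.single i 1)) :=
    (integrable_map_measure .of_discrete .of_discrete).2 hh
  simpa [NNReal.smul_def] using h1.1 (h2.smul_measure ENNReal.ofReal_ne_top)

theorem integrable_coord_poisson {n : ℕ} {ν : Fin n → ℝ} (hν : ∀ i, 0 ≤ ν i)
    {m : Measure (Fin n → ℕ)} [IsFiniteMeasure m]
    (hm : ∀ y, m {y} = ENNReal.ofReal (poisPMF ν y)) (i : Fin n) :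
    Integrable (fun y => (y i : ℝ)) m := by
  simpa using integrable_coord_mul_poisson hν hm i (h := fun _ => 1) (integrable_const _)

theorem integrable_coord_sq_poisson {n : ℕ} {ν : Fin n → ℝ} (hν : ∀ i, 0 ≤ ν i)
    {m : Measure (Fin n → ℕ)} [IsFiniteMeasure m]
    (hm : ∀ y, m {y} = ENNReal.ofReal (poisPMF ν y)) (i : Fin n) :
    Integrable (fun y => (y i : ℝ) ^ 2) m := by
  simp_rw [pow_two]
  refine integrable_coord_mul_poisson hν hm i (h := fun y => (y i : ℝ)) ?_
  simpa using (integrable_coord_poisson hν hm i).add (integrable_const 1)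

theorem integral_coord_poisson {n : ℕ} {ν : Fin n → ℝ} (hν : ∀ i, 0 ≤ ν i)
    {m : Measure (Fin n → ℕ)} [IsProbabilityMeasure m]
    (hm : ∀ y, m {y} = ENNReal.ofReal (poisPMF ν y)) (i : Fin n) :
    ∫ y, (y i : ℝ) ∂m = ν i := by
  simpa using integral_coord_mul_poisson hν hm i (fun _ => 1)

theorem IndepDiscrete.indepFun {Ω : Type*} [MeasurableSpace Ω] {n : ℕ} {P : Measure Ω}
    [IsFiniteMeasure P] {Y Z : Ω → Fin n → ℕ} (hY : Measurable Y) (hZ : Measurable Z)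
    (h : IndepDiscrete P Y Z) : IndepFun Y Z P := by
  rw [indepFun_iff_map_prod_eq_prod_map_map hY.aemeasurable hZ.aemeasurable]
  refine Measure.ext_of_singleton fun ⟨y, z⟩ => ?_
  rw [← singleton_prod_singleton, Measure.prod_prod,
    Measure.map_apply hY (measurableSet_singleton y),
    Measure.map_apply hZ (measurableSet_singleton z),
    Measure.map_apply (hY.prodMk hZ)
      ((measurableSet_singleton y).prod (measurableSet_singleton z))]
  exact h y z

theorem HasPoissonLaw.map_singleton {Ω : Type*} [MeasurableSpace Ω] {n : ℕ} {P : Measure Ω}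
    {ν : Fin n → ℝ} {Y : Ω → Fin n → ℕ} (hYm : Measurable Y) (hY : HasPoissonLaw P ν Y)
    (y : Fin n → ℕ) : P.map Y {y} = ENNReal.ofReal (poisPMF ν y) := by
  rw [Measure.map_apply hYm (measurableSet_singleton y)]
  exact hY y

/-- `UE^sqr(Y) = ‖Y‖² + ‖g(Y)‖² - 2⟨g_-(Y), Y⟩` is unbiased for
`Err^sqr(g) = E‖Ỹ - g(Y)‖²` in the Poisson means problem. -/
theorem stmt5 {n : ℕ} {Ω : Type*} [MeasurableSpace Ω] (P : Measure Ω) [IsProbabilityMeasure P]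
    (μ : Fin n → ℝ) (hμ : ∀ i, 0 ≤ μ i)
    (Y Yt : Ω → Fin n → ℕ) (hYm : Measurable Y) (hYtm : Measurable Yt)
    (hY : HasPoissonLaw P μ Y) (hYt : HasPoissonLaw P μ Yt)
    (hind : IndepDiscrete P Y Yt)
    (g : (Fin n → ℕ) → Fin n → ℝ)
    (hg2 : Integrable (fun ω => ∑ i, (g (Y ω) i) ^ 2) P)
    (hcross : ∀ i, Integrable (fun ω => (Y ω i : ℝ) * g (Y ω - Pi.single i 1) i) P) :
    (∫ ω, ((∑ i, (Y ω i : ℝ) ^ 2) + (∑ i, (g (Y ω) i) ^ 2)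
        - 2 * ∑ i, (Y ω i : ℝ) * g (Y ω - Pi.single i 1) i) ∂P)
      = ∫ ω, (∑ i, ((Yt ω i : ℝ) - g (Y ω) i) ^ 2) ∂P := by
  have := Measure.isProbabilityMeasure_map (μ := P) hYm.aemeasurable
  have := Measure.isProbabilityMeasure_map (μ := P) hYtm.aemeasurable
  have hm := hY.map_singleton hYm
  have hmt := hYt.map_singleton hYtm
  have hlaw : P.map Y = P.map Yt := Measure.ext_of_singleton fun y => by rw [hm, hmt]
  have hindep := hind.indepFun hYm hYtm
  have hgm (i : Fin n) : Measurable fun ω => g (Y ω) i :=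
    (Measurable.of_discrete (f := fun y => g y i)).comp hYm
  have integral_comp (f : (Fin n → ℕ) → ℝ) : ∫ ω, f (Y ω) ∂P = ∫ y, f y ∂(P.map Y) :=
    (integral_map hYm.aemeasurable .of_discrete).symm
  have integral_comp_copy (f : (Fin n → ℕ) → ℝ) : ∫ ω, f (Yt ω) ∂P = ∫ y, f y ∂(P.map Yt) :=
    (integral_map hYtm.aemeasurable .of_discrete).symm
  have hgsq (i : Fin n) : Integrable (fun ω => g (Y ω) i ^ 2) P := by
    refine hg2.mono' ((hgm i).pow_const 2).aestronglyMeasurable (.of_forall fun ω => ?_)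
    rw [Real.norm_of_nonneg (sq_nonneg _)]
    exact Finset.single_le_sum (f := fun j => g (Y ω) j ^ 2) (fun j _ => sq_nonneg _)
      (Finset.mem_univ i)
  have hg (i : Fin n) : Integrable (fun ω => g (Y ω) i) P :=
    ((memLp_two_iff_integrable_sq (hgm i).aestronglyMeasurable).2 (hgsq i)).integrable
      one_le_two
  have hYsq (i : Fin n) : Integrable (fun ω => (Y ω i : ℝ) ^ 2) P :=
    (integrable_coord_sq_poisson hμ hm i).comp_measurable hYm
  have hYtsq (i : Fin n) : Integrable (fun ω => (Yt ω i : ℝ) ^ 2) P :=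
    (integrable_coord_sq_poisson hμ hmt i).comp_measurable hYtm
  have hYt1 (i : Fin n) : Integrable (fun ω => (Yt ω i : ℝ)) P :=
    (integrable_coord_poisson hμ hmt i).comp_measurable hYtm
  have hindep' (i : Fin n) : IndepFun (fun ω => (Yt ω i : ℝ)) (fun ω => g (Y ω) i) P :=
    hindep.symm.comp (φ := fun y : Fin n → ℕ => (y i : ℝ)) (ψ := fun y => g y i) .of_discrete .of_discrete
  have hmul (i : Fin n) : Integrable (fun ω => (Yt ω i : ℝ) * g (Y ω) i) P :=
    (hindep' i).integrable_mul (hYt1 i) (hg i)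
  have hsq (i : Fin n) : ∫ ω, (Y ω i : ℝ) ^ 2 ∂P = ∫ ω, (Yt ω i : ℝ) ^ 2 ∂P := by
    rw [integral_comp fun y => (y i : ℝ) ^ 2, integral_comp_copy fun y => (y i : ℝ) ^ 2, hlaw]
  have hstein (i : Fin n) : ∫ ω, (Y ω i : ℝ) * g (Y ω - Pi.single i 1) i ∂P
      = ∫ ω, (Yt ω i : ℝ) * g (Y ω) i ∂P := by
    refine (integral_comp fun y => (y i : ℝ) * g (y - Pi.single i 1) i).trans ?_
    rw [(hindep' i).integral_fun_mul_eq_mul_integral (hYt1 i).aestronglyMeasurable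
        (hg i).aestronglyMeasurable,
      integral_comp_copy fun y => (y i : ℝ), integral_coord_poisson hμ hmt,
      integral_comp fun y => g y i]
    refine (integral_coord_mul_poisson hμ hm i fun y => g (y - Pi.single i 1) i).trans ?_
    simp only [add_tsub_cancel_right]
  have hexpand (i : Fin n) : ∫ ω, ((Yt ω i : ℝ) - g (Y ω) i) ^ 2 ∂P
      = ∫ ω, (Yt ω i : ℝ) ^ 2 ∂P - 2 * ∫ ω, (Yt ω i : ℝ) * g (Y ω) i ∂P
        + ∫ ω, g (Y ω) i ^ 2 ∂P := by
    rw [← integral_const_mul, ← integral_sub (hYtsq i) ((hmul i).const_mul 2)]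
    refine Eq.trans ?_ (integral_add ((hYtsq i).sub ((hmul i).const_mul 2)) (hgsq i))
    congr 1 with ω
    ring
  have hdiff (i : Fin n) : Integrable (fun ω => ((Yt ω i : ℝ) - g (Y ω) i) ^ 2) P := by
    convert! ((hYtsq i).sub ((hmul i).const_mul 2)).add (hgsq i) using 1
    ext ω
    simp only [Pi.add_apply, Pi.sub_apply]
    ring
  have hYsum : Integrable (fun ω => ∑ i, (Y ω i : ℝ) ^ 2) P :=
    integrable_finsetSum _ fun i _ => hYsq i
  refine (integral_sub (hYsum.add hg2)
    ((integrable_finsetSum _ fun i _ => hcross i).const_mul 2)).trans ?_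
  simp only [Pi.add_apply]
  rw [integral_add hYsum hg2, integral_const_mul, integral_finsetSum _ fun i _ => hYsq i,
    integral_finsetSum _ fun i _ => hgsq i, integral_finsetSum _ fun i _ => hcross i,
    integral_finsetSum _ fun i _ => hdiff i]
  simp_rw [hexpand, hsq, hstein, Finset.sum_add_distrib, Finset.sum_sub_distrib,
    ← Finset.mul_sum]
  ring
end
end

section
/- (Noiseless limit of the coupled bootstrap.) Fix y ∈ ℤ_+^n, a function g : ℤ_+^n → ℝ^n, and a Bregman divergence D_φ with separable generator φ(x) = Σ_i φ_i(x_i), such that |φ_i(g_i(y))| < ∞, |∇_iφ(g(y))| < ∞, and |∇_iφ(g(y − e_i))| < ∞ for each i, and such that for every p ∈ (0,1) the expectation below is finite. For ω with ω_i ~ Binomial(y_i, p) independent, set Y* = y − ω and Y† = ((1−p)/p)ω. Then lim_{p → 0} E[ D_φ(Y†, g(Y*)) + φ(Y*) − φ(Y†) ] = D_φ(y, g(y)) + ⟨∇φ(g(y)), y⟩ − ⟨∇φ(g_−(y)), y⟩ = UE evaluated at y, where g_−(y) = (g_1(y−e_1),…,g_n(y−e_n)) with terms involving g_i(y − e_i)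 set to 0 when y_i = 0. Consequently, for Y ~ Pois(μ), lim_{p→0} E[CB_p(g) | Y] = UE(g) almost surely. -/
open MeasureTheory ProbabilityTheory Filter Set

noncomputable section

/-- The coefficient `k * binomPMF m k p / p`, as a polynomial in `p`. -/
def binomPMFDiv (m k : ℕ) (p : ℝ) : ℝ :=
  (k : ℝ) * ((m.choose k : ℝ) * p ^ (k - 1) * (1 - p) ^ (m - k))

theorem binomPMF_zero_right (m k : ℕ) : binomPMF m k 0 = if k = 0 then 1 else 0 := by
  by_cases hk : k = 0 <;> simp [binomPMF, hk]

theorem binomPMFDiv_zero_right (m k : ℕ) :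
    binomPMFDiv m k 0 = if k = 1 then (m : ℝ) else 0 := by
  rcases k with _ | _ | k <;> simp [binomPMFDiv]

theorem binomPMF_mul_div (m k : ℕ) {p : ℝ} (hp : p ≠ 0) :
    binomPMF m k p * ((1 - p) / p * (k : ℝ)) = (1 - p) * binomPMFDiv m k p := by
  rcases k with _ | k
  · simp [binomPMFDiv]
  · simp only [binomPMF, binomPMFDiv, Nat.add_sub_cancel, pow_succ p k]
    field_simp

theorem binomJointPMF_eq_zero {n : ℕ} (y w : Fin n → ℕ) (p : ℝ)
    (hw : w ∉ Finset.Iic y) : binomJointPMF y p w = 0 := by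
  obtain ⟨i, hi⟩ : ∃ i, y i < w i := by
    simpa [Pi.le_def] using hw
  exact Finset.prod_eq_zero (Finset.mem_univ i) (by simp [binomPMF, Nat.choose_eq_zero_of_lt hi])

theorem binomJointPMF_zero_right {n : ℕ} (y w : Fin n → ℕ) :
    binomJointPMF y 0 w = if w = 0 then 1 else 0 := by
  simp only [binomJointPMF, binomPMF_zero_right]
  split_ifs with h
  · simp [h]
  · obtain ⟨i, hi⟩ := Function.ne_iff.mp h
    exact Finset.prod_eq_zero (Finset.mem_univ i) (if_neg hi)

/-- `binomJointPMF y p w * w i / p`, as a polynomial in `p`. -/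
def binomJointPMFDiv {n : ℕ} (y : Fin n → ℕ) (p : ℝ) (w : Fin n → ℕ) (i : Fin n) : ℝ :=
  binomPMFDiv (y i) (w i) p * ∏ j ∈ Finset.univ.erase i, binomPMF (y j) (w j) p

theorem binomJointPMF_mul_div {n : ℕ} (y w : Fin n → ℕ) (i : Fin n) {p : ℝ} (hp : p ≠ 0) :
    binomJointPMF y p w * ((1 - p) / p * (w i : ℝ)) = (1 - p) * binomJointPMFDiv y p w i := by
  rw [binomJointPMF, ← Finset.mul_prod_erase _ _ (Finset.mem_univ i), mul_right_comm,
    binomPMF_mul_div _ _ hp, binomJointPMFDiv, mul_assoc]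

theorem binomJointPMFDiv_zero_right {n : ℕ} (y w : Fin n → ℕ) (i : Fin n) :
    binomJointPMFDiv y 0 w i = if w = Pi.single i 1 then (y i : ℝ) else 0 := by
  simp only [binomJointPMFDiv, binomPMFDiv_zero_right, binomPMF_zero_right]
  split_ifs with h₁ h₂ h₂
  · rw [Finset.prod_eq_one, mul_one]
    intro j hj
    simp [h₂, Finset.ne_of_mem_erase hj]
  · obtain ⟨j, hj⟩ := Function.ne_iff.mp h₂
    have hji : j ≠ i := by
      rintro rfl
      simp [h₁] at hj
    rw [Finset.prod_eq_zero (Finset.mem_erase.mpr ⟨hji, Finset.mem_univ j⟩), mul_zero]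
    exact if_neg (by simpa [hji] using hj)
  · simp [h₂] at h₁
  · simp

theorem continuous_binomJointPMF {n : ℕ} (y w : Fin n → ℕ) :
    Continuous fun p => binomJointPMF y p w := by
  unfold binomJointPMF binomPMF
  fun_prop

theorem continuous_binomJointPMFDiv {n : ℕ} (y w : Fin n → ℕ) (i : Fin n) :
    Continuous fun p => binomJointPMFDiv y p w i := by
  unfold binomJointPMFDiv binomPMFDiv binomPMF
  fun_prop

/-- As `p → 0`, the binomial expectation of `C ω - ∑ i, ((1 - p) / p) ω_i D ω i` converges to
`C 0 - ∑ i, y_i D e_i i`. -/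
theorem tendsto_sum_binomJointPMF {n : ℕ} (y : Fin n → ℕ) (C : (Fin n → ℕ) → ℝ)
    (D : (Fin n → ℕ) → Fin n → ℝ) :
    Tendsto (fun p : ℝ => ∑ w ∈ Finset.Iic y, binomJointPMF y p w *
        (C w - ∑ i, D w i * ((1 - p) / p * (w i : ℝ))))
      (nhdsWithin 0 (Set.Ioo 0 1))
      (nhds (C 0 - ∑ i, (y i : ℝ) * D (Pi.single i 1) i)) := by
  let H : ℝ → ℝ := fun p => ∑ w ∈ Finset.Iic y, (binomJointPMF y p w * C w -
    ∑ i, D w i * ((1 - p) * binomJointPMFDiv y p w i))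
  have hH : Continuous H := by
    have h₁ := continuous_binomJointPMF y
    have h₂ := continuous_binomJointPMFDiv y
    fun_prop
  have hH0 : H 0 = C 0 - ∑ i, (y i : ℝ) * D (Pi.single i 1) i := by
    simp only [H, binomJointPMF_zero_right, binomJointPMFDiv_zero_right, Finset.sum_sub_distrib]
    congr 1
    · simp
    · rw [Finset.sum_comm]
      refine Finset.sum_congr rfl fun i _ => ?_
      simp only [sub_zero, one_mul, mul_ite, mul_zero, Finset.sum_ite_eq']
      split_ifs with h
      · ring
      · have hy : y i = 0 := by
          by_contra hy
          refine h (Finset.mem_Iic.mpr fun j => ?_)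
          rcases eq_or_ne j i with rfl | hj
          · simpa using Nat.one_le_iff_ne_zero.mpr hy
          · simp [hj]
        simp [hy]
  rw [← hH0]
  refine ((hH.tendsto 0).mono_left nhdsWithin_le_nhds).congr' ?_
  filter_upwards [self_mem_nhdsWithin] with p hp
  refine Finset.sum_congr rfl fun w _ => ?_
  rw [mul_sub, Finset.mul_sum]
  congr 1
  refine Finset.sum_congr rfl fun i _ => ?_
  rw [← binomJointPMF_mul_div y w i hp.1.ne']
  ring

/-- noiseless limit of the coupled bootstrap: for a separable generator
`φ(x) = Σ_i φ_i(x_i)`, as `p → 0`,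
`E[D_φ(Y†, g(Y*)) + φ(Y*) - φ(Y†)] → D_φ(y, g(y)) + ⟨∇φ(g(y)), y⟩ - ⟨∇φ(g_-(y)), y⟩`. -/
theorem stmt15 {n : ℕ} (y : Fin n → ℕ) (g : (Fin n → ℕ) → Fin n → ℝ)
    (φi : Fin n → ℝ → ℝ) (φi' : Fin n → ℝ → ℝ)
    (hconv : ∀ i, ConvexOn ℝ Set.univ (φi i))
    (hderiv : ∀ i x, HasDerivAt (φi i) (φi' i x) x)
    (hsum : ∀ p ∈ Set.Ioo (0 : ℝ) 1, Summable (fun w : Fin n → ℕ =>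
      binomJointPMF y p w *
        (breg (fun x => ∑ i, φi i (x i)) (fun x i => φi' i (x i))
            (fun i => (1 - p) / p * (w i : ℝ)) (g (y - w))
          + (∑ i, φi i ((y - w) i : ℝ)) - ∑ i, φi i ((1 - p) / p * (w i : ℝ))))) :
    Tendsto (fun p : ℝ => ∑' w : Fin n → ℕ,
        binomJointPMF y p w *
          (breg (fun x => ∑ i, φi i (x i)) (fun x i => φi' i (x i))
              (fun i => (1 - p) / p * (w i : ℝ)) (g (y - w))
            + (∑ i, φi i ((y - w) i : ℝ)) - ∑ i, φi i ((1 - p) / p * (w i : ℝ))))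
      (nhdsWithin 0 (Set.Ioo 0 1))
      (nhds (breg (fun x => ∑ i, φi i (x i)) (fun x i => φi' i (x i)) (toR y) (g y)
        + (∑ i, φi' i (g y i) * (y i : ℝ))
        - ∑ i, (y i : ℝ) * φi' i (g (y - Pi.single i 1) i))) := by
  have key := tendsto_sum_binomJointPMF y
    (fun w => (∑ i, φi i ((y - w) i : ℝ)) - (∑ i, φi i (g (y - w) i))
      + ∑ i, φi' i (g (y - w) i) * g (y - w) i)
    (fun w i => φi' i (g (y - w) i))
  convert key using 1
  · funext p
    rw [tsum_eq_sum fun w hw => by rw [binomJointPMF_eq_zero y w p hw, zero_mul]]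
    refine Finset.sum_congr rfl fun w _ => ?_
    simp only [breg, dotR, mul_sub, Finset.sum_sub_distrib]
    ring
  · simp only [breg, dotR, toR, mul_sub, Finset.sum_sub_distrib, tsub_zero]
    congr 1
    ring
end
end

section
/- (Exact bias identity.) For 0 ≤ t < 1 let Y_t, Ỹ_t ~ Pois((1−t)μ) be independent and Err_t(g) = E[D_φ(Ỹ_t, g(Y_t))]. Fix p ∈ [0,1) and assume E[ D_φ(Ỹ_t, g(Y_t)) · ⟨Y_t + Ỹ_t, 1_n⟩ ] < ∞ for all t ∈ [0,p]. Then Err_p(g) − Err(g) = − ∫_0^p (1/(1−t)) · Cov( D_φ(Ỹ_t, g(Y_t)), ⟨Ỹ_t + Y_t, 1_n⟩ ) dt. -/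
open MeasureTheory ProbabilityTheory Filter Set

noncomputable section

/-- Mean-shrunken test error `Err_p(g) = E[D_φ(Ỹ_p, g(Y_p))]`,
`Y_p, Ỹ_p ~ Pois((1-p)μ)` independent, written as a sum over the discrete sample space. -/
def errFn {n : ℕ} (μ : Fin n → ℝ) (g : (Fin n → ℕ) → Fin n → ℝ)
    (φ : (Fin n → ℝ) → ℝ) (φ' : (Fin n → ℝ) → Fin n → ℝ) (p : ℝ) : ℝ :=
  ∑' yz : (Fin n → ℕ) × (Fin n → ℕ),
    poisPMF (fun i => (1 - p) * μ i) yz.1 * poisPMF (fun i => (1 - p) * μ i) yz.2 *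
      breg φ φ' (toR yz.2) (g yz.1)

/-- `E[D_φ(Ỹ_p, g(Y_p)) ⟨Ỹ_p + Y_p, 1_n⟩]` for `Y_p, Ỹ_p ~ Pois((1-p)μ)` independent. -/
def crossFn {n : ℕ} (μ : Fin n → ℝ) (g : (Fin n → ℕ) → Fin n → ℝ)
    (φ : (Fin n → ℝ) → ℝ) (φ' : (Fin n → ℝ) → Fin n → ℝ) (p : ℝ) : ℝ :=
  ∑' yz : (Fin n → ℕ) × (Fin n → ℕ),
    poisPMF (fun i => (1 - p) * μ i) yz.1 * poisPMF (fun i => (1 - p) * μ i) yz.2 *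
      breg φ φ' (toR yz.2) (g yz.1) * (∑ i, ((yz.1 i : ℝ) + (yz.2 i : ℝ)))

/-- Scaling the mean of a Poisson vector factors out of the joint pmf. -/
lemma poisPMF_smul {n : ℕ} (μ : Fin n → ℝ) (s : ℝ) (y : Fin n → ℕ) :
    poisPMF (fun i => s * μ i) y
      = Real.exp (-(s * ∑ i, μ i)) * s ^ (∑ i, y i) * ∏ i, (μ i ^ y i / Nat.factorial (y i)) := by
  unfold poisPMF
  rw [Finset.mul_sum, ← Finset.sum_neg_distrib, Real.exp_sum, ← Finset.prod_pow_eq_pow_sum,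
    ← Finset.prod_mul_distrib, ← Finset.prod_mul_distrib]
  refine Finset.prod_congr rfl fun i _ => ?_
  rw [mul_pow]
  ring

lemma hasDerivAt_exp_mul_pow (M c : ℝ) (N : ℕ) {t : ℝ} (ht : t < 1) :
    HasDerivAt (fun t : ℝ => Real.exp (-(2 * (1 - t) * M)) * (1 - t) ^ N * c)
      (-((1 - t)⁻¹ * (Real.exp (-(2 * (1 - t) * M)) * (1 - t) ^ N * c * N
        - Real.exp (-(2 * (1 - t) * M)) * (1 - t) ^ N * c * (2 * (1 - t) * M)))) t := by
  have hne : (1 - t) ≠ 0 := by linarith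
  have h1 : HasDerivAt (fun t : ℝ => 1 - t) (-1) t := by
    simpa using (hasDerivAt_id t).const_sub 1
  have h2 : HasDerivAt (fun t : ℝ => -(2 * (1 - t) * M)) (2 * M) t := by
    refine ((h1.const_mul 2).mul_const M).fun_neg.congr_deriv ?_
    ring
  refine ((h2.exp.fun_mul (h1.fun_pow N)).mul_const c).congr_deriv ?_
  rcases N with _ | N
  · simp
    field_simp
  · simp only [Nat.add_sub_cancel, pow_succ]
    field_simp
    push_cast
    ring

lemma abs_exp_mul_pow_le {M : ℝ} (hM : 0 ≤ M) (c : ℝ) (N : ℕ) {t : ℝ} (ht0 : 0 ≤ t)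
    (ht1 : t < 1) : |Real.exp (-(2 * (1 - t) * M)) * (1 - t) ^ N * c| ≤ |c| := by
  have hs : 0 ≤ 1 - t := by linarith
  rw [abs_mul, abs_of_nonneg (by positivity)]
  refine mul_le_of_le_one_left (abs_nonneg c) (mul_le_one₀ ?_ (by positivity) ?_)
  · rw [Real.exp_le_one_iff]
    have : 0 ≤ 2 * (1 - t) * M := by positivity
    linarith
  · exact pow_le_one₀ hs (by linarith)

/-- Termwise integration of the derivative of `t ↦ ∑ e^{-2(1-t)M} (1-t)^{N k} c k`. -/
lemma tsum_exp_mul_pow_sub {ι : Type*} [Countable ι] {M : ℝ} (hM : 0 ≤ M) (c : ι → ℝ)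
    (N : ι → ℕ) {p : ℝ} (hp0 : 0 ≤ p) (hp1 : p < 1) (f : ι → ℝ → ℝ)
    (hf : ∀ k t, f k t = Real.exp (-(2 * (1 - t) * M)) * (1 - t) ^ N k * c k)
    (hsum1 : ∀ t ∈ Set.Icc 0 p, Summable fun k => f k t)
    (hsum2 : ∀ t ∈ Set.Icc 0 p, Summable fun k => f k t * N k) :
    ∑' k, f k p - ∑' k, f k 0
      = -∫ t in (0 : ℝ)..p, (1 - t)⁻¹ *
          (∑' k, f k t * N k - (∑' k, f k t) * (2 * (1 - t) * M)) := by
  set f' : ι → ℝ → ℝ :=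
    fun k t => -((1 - t)⁻¹ * (f k t * N k - f k t * (2 * (1 - t) * M))) with hf'
  have hfe : ∀ k, f k = fun t => Real.exp (-(2 * (1 - t) * M)) * (1 - t) ^ N k * c k :=
    fun k => funext (hf k)
  have hfc : ∀ k, Continuous (f k) := fun k => by rw [hfe]; fun_prop
  have hderiv : ∀ k, ∀ t < 1, HasDerivAt (f k) (f' k t) t := by
    intro k t ht
    simp only [hf', hfe]
    exact hasDerivAt_exp_mul_pow M (c k) (N k) ht
  have hcont : ∀ k, ContinuousOn (f' k) (Set.uIcc 0 p) := by
    intro k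
    rw [Set.uIcc_of_le hp0]
    refine ((ContinuousOn.inv₀ (by fun_prop) fun t ht => ?_).mul ?_).neg
    · have := ht.2
      linarith
    · have := hfc k
      fun_prop
  have hmem0 : (0 : ℝ) ∈ Set.Icc 0 p := ⟨le_rfl, hp0⟩
  have hmemp : p ∈ Set.Icc 0 p := ⟨hp0, le_rfl⟩
  have hc : ∀ k, c k = Real.exp (2 * M) * f k 0 := by
    intro k
    rw [hf, sub_zero, one_pow, mul_one, mul_one, ← mul_assoc, ← Real.exp_add]
    simp
  have hc1 : Summable fun k => |c k| := by
    exact (((hsum1 0 hmem0).mul_left (Real.exp (2 * M))).congr fun k => (hc k).symm).abs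
  have hc2 : Summable fun k => |c k| * N k := by
    have h : Summable fun k => c k * N k := by
      refine ((hsum2 0 hmem0).mul_left (Real.exp (2 * M))).congr fun k => ?_
      rw [hc, mul_assoc]
    simpa [abs_mul] using h.abs
  have hbsum : Summable fun k => (1 - p)⁻¹ * (|c k| * N k + |c k| * (2 * M)) :=
    (hc2.add (hc1.mul_right _)).mul_left _
  have hbound : ∀ k, ∀ t ∈ Set.Icc 0 p,
      ‖f' k t‖ ≤ (1 - p)⁻¹ * (|c k| * N k + |c k| * (2 * M)) := by
    intro k t ht
    have ht1 : t < 1 := ht.2.trans_lt hp1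
    have hs : 0 < 1 - t := by linarith
    have hfle : |f k t| ≤ |c k| := by
      rw [hf]
      exact abs_exp_mul_pow_le hM (c k) (N k) ht.1 ht1
    rw [hf', norm_neg, norm_mul, Real.norm_eq_abs, Real.norm_eq_abs, abs_of_pos (inv_pos.2 hs)]
    have hps : 0 < 1 - p := by linarith
    have hinv : (1 - t)⁻¹ ≤ (1 - p)⁻¹ := inv_anti₀ hps (by linarith [ht.2])
    refine mul_le_mul hinv ((abs_sub _ _).trans ?_) (abs_nonneg _) (by positivity)
    rw [abs_mul, abs_mul, Nat.abs_cast, abs_of_nonneg (by positivity : 0 ≤ 2 * (1 - t) * M)]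
    have h2M : 2 * (1 - t) * M ≤ 2 * M := by nlinarith [ht.1]
    gcongr
  have hseries : ∀ t ∈ Set.Icc 0 p, HasSum (fun k => f' k t)
      (-((1 - t)⁻¹ * (∑' k, f k t * N k - (∑' k, f k t) * (2 * (1 - t) * M)))) := fun t ht =>
    (((hsum2 t ht).hasSum.sub ((hsum1 t ht).hasSum.mul_right _)).mul_left _).neg
  have hsub : Set.uIoc 0 p ⊆ Set.Icc 0 p := by
    rw [Set.uIoc_of_le hp0]
    exact Set.Ioc_subset_Icc_self
  have hint := intervalIntegral.hasSum_integral_of_dominated_convergence (μ := volume)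
    (fun k _ => (1 - p)⁻¹ * (|c k| * N k + |c k| * (2 * M)))
    (fun k => ((hcont k).mono Set.uIoc_subset_uIcc).aestronglyMeasurable measurableSet_uIoc)
    (fun k => .of_forall fun t ht => hbound k t (hsub ht))
    (.of_forall fun _ _ => hbsum)
    intervalIntegrable_const
    (.of_forall fun t ht => hseries t (hsub ht))
  have hftc : ∀ k, ∫ t in (0 : ℝ)..p, f' k t = f k p - f k 0 := by
    intro k
    refine intervalIntegral.integral_eq_sub_of_hasDerivAt (fun t ht => ?_)
      (hcont k).intervalIntegrable
    rw [Set.uIcc_of_le hp0] at ht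
    exact hderiv k t (ht.2.trans_lt hp1)
  simp only [hftc, intervalIntegral.integral_neg] at hint
  exact ((hsum1 p hmemp).hasSum.sub (hsum1 0 hmem0).hasSum).unique hint

/-- exact bias identity:
`Err_p(g) - Err(g) = -∫_0^p (1/(1-t)) Cov(D_φ(Ỹ_t, g(Y_t)), ⟨Ỹ_t + Y_t, 1_n⟩) dt`. -/
theorem stmt16 {n : ℕ} (μ : Fin n → ℝ) (hμ : ∀ i, 0 ≤ μ i)
    (g : (Fin n → ℕ) → Fin n → ℝ)
    (φ : (Fin n → ℝ) → ℝ) (φ' : (Fin n → ℝ) → Fin n → ℝ)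
    (hconv : ConvexOn ℝ Set.univ φ) (hgrad : HasGrad φ φ')
    (p : ℝ) (hp0 : 0 ≤ p) (hp1 : p < 1)
    (hsum1 : ∀ t ∈ Set.Icc 0 p, Summable (fun yz : (Fin n → ℕ) × (Fin n → ℕ) =>
      poisPMF (fun i => (1 - t) * μ i) yz.1 * poisPMF (fun i => (1 - t) * μ i) yz.2 *
        breg φ φ' (toR yz.2) (g yz.1)))
    (hsum2 : ∀ t ∈ Set.Icc 0 p, Summable (fun yz : (Fin n → ℕ) × (Fin n → ℕ) =>
      poisPMF (fun i => (1 - t) * μ i) yz.1 * poisPMF (fun i => (1 - t) * μ i) yz.2 *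
        breg φ φ' (toR yz.2) (g yz.1) * (∑ i, ((yz.1 i : ℝ) + (yz.2 i : ℝ))))) :
    errFn μ g φ φ' p - errFn μ g φ φ' 0
      = -∫ t in (0 : ℝ)..p, (1 - t)⁻¹ *
          (crossFn μ g φ φ' t - errFn μ g φ φ' t * (2 * (1 - t) * ∑ i, μ i)) := by
  set N : (Fin n → ℕ) × (Fin n → ℕ) → ℕ := fun yz => ∑ i, (yz.1 i + yz.2 i) with hN
  have hNcast : ∀ yz : (Fin n → ℕ) × (Fin n → ℕ),
      ∑ i, ((yz.1 i : ℝ) + (yz.2 i : ℝ)) = (N yz : ℝ) := fun yz => by simp [hN]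
  simp only [hNcast] at hsum2
  simp only [errFn, crossFn, hNcast]
  refine tsum_exp_mul_pow_sub (Finset.sum_nonneg fun i _ => hμ i)
    (fun yz => (∏ i, (μ i ^ yz.1 i / Nat.factorial (yz.1 i))) *
      (∏ i, (μ i ^ yz.2 i / Nat.factorial (yz.2 i))) * breg φ φ' (toR yz.2) (g yz.1))
    N hp0 hp1 (fun yz t => poisPMF (fun i => (1 - t) * μ i) yz.1 *
      poisPMF (fun i => (1 - t) * μ i) yz.2 * breg φ φ' (toR yz.2) (g yz.1)) ?_ hsum1 hsum2
  intro yz t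
  have hexp : Real.exp (-(2 * (1 - t) * ∑ i, μ i))
      = Real.exp (-((1 - t) * ∑ i, μ i)) * Real.exp (-((1 - t) * ∑ i, μ i)) := by
    rw [← Real.exp_add]
    ring_nf
  simp only [poisPMF_smul, hN, Finset.sum_add_distrib, pow_add, hexp]
  ring
end
end
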